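/- arXiv:1606.04215 — 2 statements merged into one kernel-verified Lean document; each statement's English description precedes it below -/
import Mathlib

section
/- For every k ∈ (0,1), the derivative with respect to k of the product E(k)·K(k) of complete elliptic integrals equals (E(k)² − (1−k²)K(k)²)/((1−k²)k), and this quantity is strictly positive. Consequently, k ↦ E(k)K(k) is strictly increasing on (0,1), ranging from π²/4 (as k → 0⁺) to ∞ (as k → 1⁻). -/
open Real

/-- Complete elliptic integral of the first kind. -/
noncomputable def ellipticK (k : ℝ) : ℝ :=
  ∫ θ in (0:ℝ)..(π/2), 1 / Real.sqrt (1 - k^2 * Real.sin θ ^ 2)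

/-- Complete elliptic integral of the second kind. -/
noncomputable def ellipticE (k : ℝ) : ℝ :=
  ∫ θ in (0:ℝ)..(π/2), Real.sqrt (1 - k^2 * Real.sin θ ^ 2)

lemma ell_pos {k : ℝ} (hk : k ^ 2 < 1) (t : ℝ) : 0 < 1 - k ^ 2 * Real.sin t ^ 2 := by
  nlinarith [Real.sin_sq_le_one t, sq_nonneg k, sq_nonneg (Real.sin t)]

lemma ell_cont {k : ℝ} (hk : k ^ 2 < 1) :
    Continuous fun t : ℝ => Real.sqrt (1 - k ^ 2 * Real.sin t ^ 2) := by fun_prop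

lemma ell_ne {k : ℝ} (hk : k ^ 2 < 1) (t : ℝ) : Real.sqrt (1 - k ^ 2 * Real.sin t ^ 2) ≠ 0 :=
  (Real.sqrt_pos.2 (ell_pos hk t)).ne'

lemma ell_contInv {k : ℝ} (hk : k ^ 2 < 1) :
    Continuous fun t : ℝ => 1 / Real.sqrt (1 - k ^ 2 * Real.sin t ^ 2) :=
  continuous_const.div (ell_cont hk) (ell_ne hk)

lemma ell_derE_pt {x : ℝ} (hx : x ^ 2 < 1) (t : ℝ) :
    HasDerivAt (fun x : ℝ => Real.sqrt (1 - x ^ 2 * Real.sin t ^ 2))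
      (-(x * Real.sin t ^ 2) / Real.sqrt (1 - x ^ 2 * Real.sin t ^ 2)) x := by
  have h1 : HasDerivAt (fun x : ℝ => 1 - x ^ 2 * Real.sin t ^ 2)
      (-(2 * x * Real.sin t ^ 2)) x := by
    have := (((hasDerivAt_id x).pow 2).mul_const (Real.sin t ^ 2)).const_sub 1
    simpa using this
  convert h1.sqrt (ell_pos hx t).ne' using 1
  have := ell_ne hx t
  field_simp

lemma ell_derK_pt {x : ℝ} (hx : x ^ 2 < 1) (t : ℝ) :
    HasDerivAt (fun x : ℝ => 1 / Real.sqrt (1 - x ^ 2 * Real.sin t ^ 2))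
      ((x * Real.sin t ^ 2) / Real.sqrt (1 - x ^ 2 * Real.sin t ^ 2) ^ 3) x := by
  have := ell_ne hx t
  have h := (ell_derE_pt hx t).inv this
  simp only [one_div]
  refine h.congr_deriv ?_
  field_simp

lemma ell_dom {x r : ℝ} (hr : r < 1) (hx : |x| < r) (t : ℝ) :
    Real.sqrt (1 - r ^ 2) ≤ Real.sqrt (1 - x ^ 2 * Real.sin t ^ 2) ∧
    |x * Real.sin t ^ 2| ≤ 1 ∧ x ^ 2 < 1 ∧ 0 < Real.sqrt (1 - r ^ 2) := by
  have h0 := abs_nonneg x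
  have h1 : x ^ 2 < r ^ 2 := by rw [← sq_abs x]; nlinarith
  have h2 : r ^ 2 < 1 := by nlinarith
  have h3 := Real.sin_sq_le_one t
  refine ⟨Real.sqrt_le_sqrt ?_, ?_, by linarith, Real.sqrt_pos.2 (by linarith)⟩
  · nlinarith [sq_nonneg x]
  · rw [abs_mul, abs_of_nonneg (sq_nonneg (Real.sin t))]
    nlinarith [sq_nonneg (Real.sin t)]

lemma ell_nhds {k : ℝ} (hk : |k| < 1) : {x : ℝ | |x| < (1 + |k|) / 2} ∈ nhds k := by
  apply (isOpen_lt continuous_abs continuous_const).mem_nhds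
  simp only [Set.mem_ofPred_eq]; linarith

lemma ell_derE {k : ℝ} (hk : |k| < 1) :
    HasDerivAt ellipticE
      (∫ t in (0:ℝ)..(π/2), -(k * Real.sin t ^ 2) / Real.sqrt (1 - k ^ 2 * Real.sin t ^ 2)) k := by
  have hr : (1 + |k|) / 2 < 1 := by linarith
  have hk2 : k ^ 2 < 1 := (sq_lt_one_iff_abs_lt_one k).2 hk
  refine (intervalIntegral.hasDerivAt_integral_of_dominated_loc_of_deriv_le
    (F := fun x t => Real.sqrt (1 - x ^ 2 * Real.sin t ^ 2))
    (F' := fun x t => -(x * Real.sin t ^ 2) / Real.sqrt (1 - x ^ 2 * Real.sin t ^ 2))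
    (bound := fun _ => 1 / Real.sqrt (1 - ((1 + |k|) / 2) ^ 2))
    (ell_nhds hk) ?_ ?_ ?_ ?_ ?_ ?_).2
  · exact Filter.Eventually.of_forall fun x =>
      (by fun_prop : Continuous fun t : ℝ =>
        Real.sqrt (1 - x ^ 2 * Real.sin t ^ 2)).aestronglyMeasurable
  · exact (ell_cont hk2).intervalIntegrable _ _
  · exact (Continuous.div (by fun_prop) (ell_cont hk2) (ell_ne hk2)).aestronglyMeasurable
  · refine Filter.Eventually.of_forall fun t _ x hx => ?_
    obtain ⟨h1, h2, h3, h4⟩ := ell_dom hr hx t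
    rw [norm_div, norm_neg, Real.norm_eq_abs, Real.norm_eq_abs, abs_of_nonneg (Real.sqrt_nonneg _)]
    gcongr
  · exact intervalIntegrable_const
  · exact Filter.Eventually.of_forall fun t _ x hx => ell_derE_pt (ell_dom hr hx t).2.2.1 t

lemma ell_derK {k : ℝ} (hk : |k| < 1) :
    HasDerivAt ellipticK
      (∫ t in (0:ℝ)..(π/2), (k * Real.sin t ^ 2) / Real.sqrt (1 - k ^ 2 * Real.sin t ^ 2) ^ 3) k := by
  have hr : (1 + |k|) / 2 < 1 := by linarith
  have hk2 : k ^ 2 < 1 := (sq_lt_one_iff_abs_lt_one k).2 hk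
  refine (intervalIntegral.hasDerivAt_integral_of_dominated_loc_of_deriv_le
    (F := fun x t => 1 / Real.sqrt (1 - x ^ 2 * Real.sin t ^ 2))
    (F' := fun x t => (x * Real.sin t ^ 2) / Real.sqrt (1 - x ^ 2 * Real.sin t ^ 2) ^ 3)
    (bound := fun _ => 1 / Real.sqrt (1 - ((1 + |k|) / 2) ^ 2) ^ 3)
    (ell_nhds hk) ?_ ?_ ?_ ?_ ?_ ?_).2
  · filter_upwards [ell_nhds hk] with x hx
    exact (ell_contInv (ell_dom hr hx 0).2.2.1).aestronglyMeasurable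
  · exact (ell_contInv hk2).intervalIntegrable _ _
  · exact (Continuous.div (by fun_prop) ((ell_cont hk2).pow 3)
      (fun t => pow_ne_zero 3 (ell_ne hk2 t))).aestronglyMeasurable
  · refine Filter.Eventually.of_forall fun t _ x hx => ?_
    obtain ⟨h1, h2, h3, h4⟩ := ell_dom hr hx t
    rw [norm_div, norm_pow, Real.norm_eq_abs, Real.norm_eq_abs, abs_of_nonneg (Real.sqrt_nonneg _)]
    gcongr
  · exact intervalIntegrable_const
  · exact Filter.Eventually.of_forall fun t _ x hx => ell_derK_pt (ell_dom hr hx t).2.2.1 t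

lemma ell_derE' {k : ℝ} (hk : k ∈ Set.Ioo (0:ℝ) 1) :
    HasDerivAt ellipticE ((ellipticE k - ellipticK k) / k) k := by
  have hk1 : |k| < 1 := by rw [abs_of_pos hk.1]; exact hk.2
  have hk2 : k ^ 2 < 1 := (sq_lt_one_iff_abs_lt_one k).2 hk1
  convert ell_derE hk1 using 1
  unfold ellipticE ellipticK
  rw [← intervalIntegral.integral_sub ((ell_cont hk2).intervalIntegrable _ _)
    ((ell_contInv hk2).intervalIntegrable _ _), ← intervalIntegral.integral_div]
  congr 1; ext t
  have h1 := ell_ne hk2 t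
  have h2 := Real.sq_sqrt (ell_pos hk2 t).le
  have h3 := hk.1.ne'
  field_simp
  rw [h2]; ring

lemma ell_cube {k : ℝ} (hk2 : k ^ 2 < 1) :
    (1 - k ^ 2) * (∫ t in (0:ℝ)..(π/2), 1 / Real.sqrt (1 - k ^ 2 * Real.sin t ^ 2) ^ 3)
      = ellipticE k := by
  have hc3 : Continuous fun t : ℝ => 1 / Real.sqrt (1 - k ^ 2 * Real.sin t ^ 2) ^ 3 :=
    continuous_const.div ((ell_cont hk2).pow 3) (fun t => pow_ne_zero 3 (ell_ne hk2 t))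
  have key : ∫ t in (0:ℝ)..(π/2), (Real.sqrt (1 - k ^ 2 * Real.sin t ^ 2)
      - (1 - k ^ 2) * (1 / Real.sqrt (1 - k ^ 2 * Real.sin t ^ 2) ^ 3)) = 
      k ^ 2 * (Real.sin (π/2) * Real.cos (π/2) / Real.sqrt (1 - k ^ 2 * Real.sin (π/2) ^ 2))
      - k ^ 2 * (Real.sin 0 * Real.cos 0 / Real.sqrt (1 - k ^ 2 * Real.sin 0 ^ 2)) := by
    apply intervalIntegral.integral_eq_sub_of_hasDerivAt
      (f := fun t => k ^ 2 * (Real.sin t * Real.cos t / Real.sqrt (1 - k ^ 2 * Real.sin t ^ 2)))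
    · intro t _
      have h1 := ell_ne hk2 t
      have h2 := Real.sq_sqrt (ell_pos hk2 t).le
      have hs : HasDerivAt (fun t : ℝ => 1 - k ^ 2 * Real.sin t ^ 2)
          (-(k ^ 2 * (2 * Real.sin t * Real.cos t))) t := by
        have := (((Real.hasDerivAt_sin t).pow 2).const_mul (k ^ 2)).const_sub 1
        simpa using this
      have hd := ((((Real.hasDerivAt_sin t).mul (Real.hasDerivAt_cos t)).div
        (hs.sqrt (ell_pos hk2 t).ne') h1).const_mul (k ^ 2))
      refine hd.congr_deriv ?_
      have hcs := Real.cos_sq' t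
      try simp only [Pi.mul_apply]
      generalize Real.sqrt (1 - k ^ 2 * Real.sin t ^ 2) = D at *
      generalize Real.sin t = s at *
      generalize Real.cos t = c at *
      have e4 : D ^ 4 = (1 - k ^ 2 * s ^ 2) ^ 2 := by rw [← h2]; ring
      field_simp
      rw [show D ^ 2 = 1 - k ^ 2 * s ^ 2 from h2] 
      first
        | (rw [e4, hcs]; ring)
        | (ring_nf; simp only [hcs, e4]; ring)
        | skip
    · exact ((ell_cont hk2).sub (continuous_const.mul hc3)).intervalIntegrable _ _
  rw [intervalIntegral.integral_sub ((ell_cont hk2).intervalIntegrable _ _)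
    ((hc3.intervalIntegrable _ _).const_mul _),
    intervalIntegral.integral_const_mul] at key
  simp only [Real.cos_pi_div_two, Real.sin_zero, mul_zero, zero_mul, zero_div, sub_zero] at key
  unfold ellipticE
  linarith

lemma ell_derK' {k : ℝ} (hk : k ∈ Set.Ioo (0:ℝ) 1) :
    HasDerivAt ellipticK ((ellipticE k - (1 - k ^ 2) * ellipticK k) / (k * (1 - k ^ 2))) k := by
  have hk1 : |k| < 1 := by rw [abs_of_pos hk.1]; exact hk.2
  have hk2 : k ^ 2 < 1 := (sq_lt_one_iff_abs_lt_one k).2 hk1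
  have hc3 : Continuous fun t : ℝ => 1 / Real.sqrt (1 - k ^ 2 * Real.sin t ^ 2) ^ 3 :=
    continuous_const.div ((ell_cont hk2).pow 3) (fun t => pow_ne_zero 3 (ell_ne hk2 t))
  convert ell_derK hk1 using 1
  have h3 := hk.1.ne'
  have h4 : 1 - k ^ 2 ≠ 0 := by linarith
  rw [← ell_cube hk2, ← mul_sub, mul_comm k, mul_div_mul_left _ _ h4]
  unfold ellipticK
  rw [← intervalIntegral.integral_sub (hc3.intervalIntegrable _ _)
    ((ell_contInv hk2).intervalIntegrable _ _), ← intervalIntegral.integral_div]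
  congr 1; ext t
  have h1 := ell_ne hk2 t
  have h2 := Real.sq_sqrt (ell_pos hk2 t).le
  field_simp
  rw [h2]; ring

lemma ellE_zero : ellipticE 0 = π / 2 := by simp [ellipticE]
lemma ellK_zero : ellipticK 0 = π / 2 := by simp [ellipticK]

lemma ell_K_sub_E {k : ℝ} (hk : k ∈ Set.Ioo (0:ℝ) 1) : ellipticE k < ellipticK k := by
  have hk1 : |k| < 1 := by rw [abs_of_pos hk.1]; exact hk.2
  have hk2 : k ^ 2 < 1 := (sq_lt_one_iff_abs_lt_one k).2 hk1
  have hle : ∀ t, Real.sqrt (1 - k ^ 2 * Real.sin t ^ 2) ≤ 1 := fun t =>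
    Real.sqrt_le_one.2 (by nlinarith [sq_nonneg (k * Real.sin t)])
  apply intervalIntegral.integral_lt_integral_of_continuousOn_of_le_of_exists_lt
    (by positivity) (ell_cont hk2).continuousOn (ell_contInv hk2).continuousOn
  · intro t _
    have := Real.sqrt_pos.2 (ell_pos hk2 t)
    exact (hle t).trans ((one_le_div this).2 (hle t))
  · refine ⟨π / 2, ⟨by positivity, le_rfl⟩, ?_⟩
    have h := Real.sqrt_pos.2 (ell_pos hk2 (π / 2))
    have h' : Real.sqrt (1 - k ^ 2 * Real.sin (π / 2) ^ 2) < 1 := by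
      rw [Real.sqrt_lt' one_pos, Real.sin_pi_div_two]; nlinarith [hk.1]
    exact h'.trans ((one_lt_div h).2 h')

lemma ell_f_pos {k : ℝ} (hk : k ∈ Set.Ioo (0:ℝ) 1) :
    0 < ellipticE k ^ 2 - (1 - k ^ 2) * ellipticK k ^ 2 := by
  have hm : StrictMonoOn (fun k => ellipticE k ^ 2 - (1 - k ^ 2) * ellipticK k ^ 2)
      (Set.Ico (0:ℝ) 1) := by
    apply strictMonoOn_of_deriv_pos (convex_Ico 0 1)
    · intro x hx
      have hx1 : |x| < 1 := by rw [abs_of_nonneg hx.1]; exact hx.2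
      have h1 := (ell_derE hx1).continuousAt
      have h2 := (ell_derK hx1).continuousAt
      exact ((h1.pow 2).sub ((continuousAt_const.sub (continuousAt_id.pow 2)).mul
        (h2.pow 2))).continuousWithinAt
    · intro x hx
      rw [interior_Ico] at hx
      have h0 := hx.1
      have h4 : 0 < 1 - x ^ 2 := by nlinarith [hx.1, hx.2]
      have hd := ((ell_derE' hx).pow 2).sub
        ((((hasDerivAt_id x).pow 2).const_sub 1).mul ((ell_derK' hx).pow 2))
      have he : HasDerivAt (fun k => ellipticE k ^ 2 - (1 - k ^ 2) * ellipticK k ^ 2)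
          (2 * (ellipticE x - ellipticK x) ^ 2 / x) x := by
        refine hd.congr_deriv ?_
        have h5 := h4.ne'
        simp
        field_simp
        ring
      rw [he.deriv]
      have := sub_neg.2 (ell_K_sub_E hx)
      have := pow_pos (neg_pos.2 this) 2
      rw [neg_sq] at this
      positivity
  have := hm ⟨le_rfl, one_pos⟩ ⟨hk.1.le, hk.2⟩ hk.1
  simpa [ellE_zero, ellK_zero] using this

lemma ell_E_ge {k : ℝ} (hk : k ∈ Set.Ioo (0:ℝ) 1) : 1 ≤ ellipticE k := by
  have hk1 : |k| < 1 := by rw [abs_of_pos hk.1]; exact hk.2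
  have hk2 : k ^ 2 < 1 := (sq_lt_one_iff_abs_lt_one k).2 hk1
  have : ∫ t in (0:ℝ)..(π/2), Real.cos t = 1 := by simp
  rw [← this]
  apply intervalIntegral.integral_mono_on (by positivity)
    (Real.continuous_cos.intervalIntegrable _ _) ((ell_cont hk2).intervalIntegrable _ _)
  intro t _
  apply Real.le_sqrt_of_sq_le
  nlinarith [Real.sin_sq_add_cos_sq t, sq_nonneg (Real.sin t)]

lemma ell_K_ge {k : ℝ} (hk : k ∈ Set.Ioo (0:ℝ) 1) :
    - Real.log (Real.sqrt (1 - k ^ 2)) ≤ ellipticK k := by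
  have hk1 : |k| < 1 := by rw [abs_of_pos hk.1]; exact hk.2
  have hk2 : k ^ 2 < 1 := (sq_lt_one_iff_abs_lt_one k).2 hk1
  have hq : 0 < Real.sqrt (1 - k ^ 2) := Real.sqrt_pos.2 (by linarith)
  have hqs := Real.sq_sqrt (show 0 ≤ 1 - k ^ 2 by linarith)
  set q := Real.sqrt (1 - k ^ 2) with hqdef
  have hu : Set.uIcc (0:ℝ) (π/2) = Set.Icc 0 (π/2) := Set.uIcc_of_le (by positivity)
  have hci : IntervalIntegrable (fun t : ℝ => 1 / (q + π / 2 - t)) MeasureTheory.volume 0 (π/2) := by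
    apply ContinuousOn.intervalIntegrable
    rw [hu]
    apply ContinuousOn.div continuousOn_const (by fun_prop)
    intro t ht
    have := ht.2
    linarith
  have hint : ∫ t in (0:ℝ)..(π/2), 1 / (q + π / 2 - t) =
      -Real.log (q + π / 2 - π / 2) - -Real.log (q + π / 2 - 0) := by
    apply intervalIntegral.integral_eq_sub_of_hasDerivAt
      (f := fun t => -Real.log (q + π / 2 - t)) _ hci
    intro t ht
    rw [hu] at ht
    have h5 : q + π / 2 - t ≠ 0 := by have := ht.2; linarith
    have := (((hasDerivAt_id t).const_sub (q + π / 2)).log h5).neg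
    refine this.congr_deriv ?_
    simp [neg_div]
  have h1 : 0 ≤ Real.log (q + π / 2 - 0) := Real.log_nonneg (by linarith [Real.pi_gt_three])
  have h2 : ∫ t in (0:ℝ)..(π/2), 1 / (q + π / 2 - t) ≤ ellipticK k := by
    apply intervalIntegral.integral_mono_on (by positivity) hci
      ((ell_contInv hk2).intervalIntegrable _ _)
    intro t ht
    apply one_div_le_one_div_of_le (Real.sqrt_pos.2 (ell_pos hk2 t))
    have hc : Real.cos t ≤ π / 2 - t := by
      rw [← Real.sin_pi_div_two_sub]
      exact Real.sin_le (by linarith [ht.2])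
    have hc0 : 0 ≤ Real.cos t := Real.cos_nonneg_of_mem_Icc ⟨by linarith [ht.1, Real.pi_pos], ht.2⟩
    apply Real.sqrt_le_iff.2 ⟨by linarith, ?_⟩
    have h6 : (q + Real.cos t) ^ 2 ≤ (q + π / 2 - t) ^ 2 := by
      apply pow_le_pow_left₀ (by linarith); linarith
    nlinarith [Real.sin_sq_add_cos_sq t, mul_nonneg hq.le hc0, sq_nonneg (Real.cos t)]
  have h7 : q + π / 2 - π / 2 = q := by ring
  rw [hint, h7] at h2
  linarith

lemma ell_der {k : ℝ} (hk : k ∈ Set.Ioo (0:ℝ) 1) :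
    HasDerivAt (fun k => ellipticE k * ellipticK k)
        ((ellipticE k ^ 2 - (1 - k^2) * ellipticK k ^ 2) / ((1 - k^2) * k)) k := by
  have h0 := hk.1.ne'
  have h4 : 1 - k ^ 2 ≠ 0 := by nlinarith [hk.1, hk.2]
  refine ((ell_derE' hk).mul (ell_derK' hk)).congr_deriv ?_
  field_simp
  ring

lemma ell_pos_der {k : ℝ} (hk : k ∈ Set.Ioo (0:ℝ) 1) :
    0 < (ellipticE k ^ 2 - (1 - k^2) * ellipticK k ^ 2) / ((1 - k^2) * k) := by
  have h4 : 0 < 1 - k ^ 2 := by nlinarith [hk.1, hk.2]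
  exact div_pos (ell_f_pos hk) (mul_pos h4 hk.1)

theorem stmt_1 :
    (∀ k ∈ Set.Ioo (0:ℝ) 1,
      HasDerivAt (fun k => ellipticE k * ellipticK k)
        ((ellipticE k ^ 2 - (1 - k^2) * ellipticK k ^ 2) / ((1 - k^2) * k)) k ∧
      0 < (ellipticE k ^ 2 - (1 - k^2) * ellipticK k ^ 2) / ((1 - k^2) * k)) ∧
    StrictMonoOn (fun k => ellipticE k * ellipticK k) (Set.Ioo (0:ℝ) 1) ∧
    Filter.Tendsto (fun k => ellipticE k * ellipticK k)
      (nhdsWithin 0 (Set.Ioo (0:ℝ) 1)) (nhds (π^2/4)) ∧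
    Filter.Tendsto (fun k => ellipticE k * ellipticK k)
      (nhdsWithin 1 (Set.Ioo (0:ℝ) 1)) Filter.atTop := by
  refine ⟨fun k hk => ⟨ell_der hk, ell_pos_der hk⟩, ?_, ?_, ?_⟩
  · apply strictMonoOn_of_deriv_pos (convex_Ioo 0 1)
    · exact fun x hx => (ell_der hx).continuousAt.continuousWithinAt
    · intro x hx
      rw [interior_Ioo] at hx
      rw [(ell_der hx).deriv]
      exact ell_pos_der hx
  · have h0 : |(0:ℝ)| < 1 := by simp
    have := (ell_derE h0).continuousAt.mul (ell_derK h0).continuousAt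
    have h := this.tendsto.mono_left (nhdsWithin_le_nhds (s := Set.Ioo (0:ℝ) 1))
    have e : π ^ 2 / 4 = (ellipticE * ellipticK) 0 := by
      rw [Pi.mul_apply, ellE_zero, ellK_zero]; ring
    rw [e]
    exact h
  · have hs : Filter.Tendsto (fun k : ℝ => Real.sqrt (1 - k ^ 2))
        (nhdsWithin 1 (Set.Ioo (0:ℝ) 1)) (nhdsWithin 0 (Set.Ioi 0)) := by
      apply tendsto_nhdsWithin_iff.2 ⟨?_, ?_⟩
      · have : Continuous fun k : ℝ => Real.sqrt (1 - k ^ 2) := by fun_prop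
        have h := (this.tendsto 1).mono_left (nhdsWithin_le_nhds (s := Set.Ioo (0:ℝ) 1))
        simpa using h
      · filter_upwards [self_mem_nhdsWithin] with k hk
        exact Real.sqrt_pos.2 (by nlinarith [hk.1, hk.2])
    have hl := Filter.tendsto_neg_atBot_atTop.comp (Real.tendsto_log_nhdsGT_zero.comp hs)
    refine Filter.tendsto_atTop_mono' _ ?_ hl
    filter_upwards [self_mem_nhdsWithin] with k hk
    have h1 := ell_E_ge hk
    have h2 := ell_K_ge hk
    have h3 := ell_K_sub_E hk
    simp only [Function.comp]
    nlinarith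
end

section
/- Let b < 0, T > 0, m > 0. The plane wave u(x) = √(2m/T) e^{2πix/T} is the unique (up to phase shift and complex conjugation) minimizer of the energy E(u) = (1/2)∫₀ᵀ|u_x|² − (b/4)∫₀ᵀ|u|⁴ over T/2-anti-periodic H¹ functions with mass m. -/
open Real

/-- The NLS energy of a `T`-periodic function. -/
noncomputable def nlsEnergy (b T : ℝ) (u : ℝ → ℂ) : ℝ :=
  (1/2) * (∫ x in (0:ℝ)..T, ‖deriv u x‖^2) - (b/4) * ∫ x in (0:ℝ)..T, ‖u x‖^4

/-- The mass of a `T`-periodic function. -/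
noncomputable def nlsMass (T : ℝ) (u : ℝ → ℂ) : ℝ :=
  (1/2) * ∫ x in (0:ℝ)..T, ‖u x‖^2

lemma aux_wirt (T : ℝ) (hT : 0 < T) (v : ℝ → ℂ) (hv : ContDiff ℝ 1 v)
    (ha : ∀ x, v (x + T/2) = -v x) :
    (2*π/T)^2 * (∫ x in (0:ℝ)..T, ‖v x‖^2) ≤ ∫ x in (0:ℝ)..T, ‖deriv v x‖^2 ∧
    ((2*π/T)^2 * (∫ x in (0:ℝ)..T, ‖v x‖^2) = ∫ x in (0:ℝ)..T, ‖deriv v x‖^2 →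
      ∃ A B : ℂ, ∀ x : ℝ, v x = A * Complex.exp (2 * π * Complex.I * x / T)
        + B * Complex.exp (-(2 * π * Complex.I * x / T))) := by
  have hc : Continuous v := hv.continuous
  have hc' : Continuous (deriv v) := hv.continuous_deriv le_rfl
  have hd : ∀ x, HasDerivAt v (deriv v x) x := fun x =>
    (hv.differentiable one_ne_zero x).hasDerivAt
  have hper : ∀ x, v (x + T) = v x := by
    intro x
    have : x + T = (x + T/2) + T/2 := by ring
    rw [this, ha, ha, neg_neg]
  have hmem : ∀ f : ℝ → ℂ, Continuous f →
      MeasureTheory.MemLp f 2 (MeasureTheory.volume.restrict (Set.Ioc 0 T)) := by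
    intro f hf
    obtain ⟨C, hC⟩ := isCompact_Icc.exists_bound_of_continuousOn (s := Set.Icc 0 T) hf.continuousOn
    refine MeasureTheory.MemLp.of_bound hf.aestronglyMeasurable C ?_
    exact MeasureTheory.ae_restrict_of_forall_mem measurableSet_Ioc
      (fun x hx => hC x (Set.Ioc_subset_Icc_self hx))
  have S1 := hasSum_sq_fourierCoeffOn hT (hmem v hc)
  have S2 := hasSum_sq_fourierCoeffOn hT (hmem _ hc')
  have hint : ∀ a b : ℝ, IntervalIntegrable v MeasureTheory.volume a b :=
    fun a b => hc.intervalIntegrable a b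
  have c0 : fourierCoeffOn hT v 0 = 0 := by
    rw [fourierCoeffOn_eq_integral]
    have h2 : ∫ x in (T/2)..T, v x = - ∫ x in (0:ℝ)..(T/2), v x := by
      have := intervalIntegral.integral_comp_add_right (a := 0) (b := T/2) v (T/2)
      rw [zero_add, add_halves] at this
      rw [← this, ← intervalIntegral.integral_neg]
      simp only [ha]
    have h3 := intervalIntegral.integral_add_adjacent_intervals (hint 0 (T/2)) (hint (T/2) T)
    rw [h2] at h3
    simp [← h3]
  have hTC : (T : ℂ) ≠ 0 := by exact_mod_cast hT.ne'
  have hpC : (π : ℂ) ≠ 0 := by exact_mod_cast Real.pi_ne_zero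
  have key : ∀ n : ℤ, ‖fourierCoeffOn hT (deriv v) n‖^2
      - (2*π/T)^2 * ‖fourierCoeffOn hT v n‖^2
      = if n = 0 then ‖fourierCoeffOn hT (deriv v) 0‖^2 else
        (2*π/T)^2 * (((n:ℝ)^2 - 1) * ‖fourierCoeffOn hT v n‖^2) := by
    intro n
    split_ifs with hn
    · subst hn; simp [c0]
    · have h := fourierCoeffOn_of_hasDerivAt hT hn (fun x _ => hd x)
        (hc'.intervalIntegrable 0 T)
      have hvT : v T = v 0 := by simpa using hper 0
      have hnC : (n : ℂ) ≠ 0 := by exact_mod_cast hn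
      rw [hvT, sub_self, mul_zero] at h
      have h' : fourierCoeffOn hT (deriv v) n
          = ((2*π/T*n : ℝ) : ℂ) * Complex.I * fourierCoeffOn hT v n := by
        rw [h]; push_cast; field_simp
        simp
      rw [h', norm_mul, norm_mul, Complex.norm_I, Complex.norm_real, mul_one, mul_pow,
        Real.norm_eq_abs, sq_abs]
      ring
  have hTi : (0:ℝ) < T⁻¹ := inv_pos.mpr hT
  have S3 := S2.sub (S1.mul_left ((2*π/T)^2))
  have hnn : ∀ n : ℤ, 0 ≤ ‖fourierCoeffOn hT (deriv v) n‖^2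
      - (2*π/T)^2 * ‖fourierCoeffOn hT v n‖^2 := by
    intro n
    rw [key]
    split_ifs with hn
    · positivity
    · have : (1:ℝ) ≤ (n:ℝ)^2 := by
        have : (1:ℤ) ≤ n^2 := by have := sq_pos_of_ne_zero hn; omega
        exact_mod_cast this
      have : 0 ≤ (n:ℝ)^2 - 1 := by linarith
      positivity
  simp only [sub_zero, smul_eq_mul] at S3
  constructor
  · have := S3.nonneg hnn
    have h4 : 0 ≤ T⁻¹ * ((∫ x in (0:ℝ)..T, ‖deriv v x‖^2)
      - (2*π/T)^2 * (∫ x in (0:ℝ)..T, ‖v x‖^2)) := by linarith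
    have := nonneg_of_mul_nonneg_right h4 hTi
    linarith
  · intro heq
    rw [← heq] at S3
    have hz : T⁻¹ * ((2*π/T)^2 * (∫ x in (0:ℝ)..T, ‖v x‖^2))
      - (2*π/T)^2 * (T⁻¹ * (∫ x in (0:ℝ)..T, ‖v x‖^2)) = 0 := by ring
    rw [hz, hasSum_zero_iff_of_nonneg hnn] at S3
    have cz : ∀ n : ℤ, n ≠ 1 → n ≠ -1 → fourierCoeffOn hT v n = 0 := by
      intro n h1 h2
      by_cases hn : n = 0
      · rw [hn]; exact c0
      have h5 := congrFun S3 n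
      simp only [Pi.zero_apply] at h5
      rw [key, if_neg hn] at h5
      have h6 : (n:ℝ)^2 - 1 ≠ 0 := by
        intro h
        have h7 : ((n:ℝ) - 1) * (n + 1) = 0 := by linarith
        have h8 : (n - 1) * (n + 1) = 0 := by exact_mod_cast h7
        rcases mul_eq_zero.mp h8 with h | h <;> omega
      have h9 : (2*π/T)^2 ≠ 0 := by positivity
      simpa [h6, h9, hT.ne', Real.pi_ne_zero] using h5
    have hF : Fact (0 < T - 0) := ⟨by simpa using hT⟩
    have hp : Function.Periodic v (T - 0) := by intro x; simpa using hper x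
    let f : C(AddCircle (T - 0), ℂ) := ⟨hp.lift, continuous_coinduced_dom.mpr hc⟩
    have hf : ∀ x : ℝ, f (x : AddCircle (T - 0)) = v x := fun x => hp.lift_coe x
    have hcoef : ∀ n, fourierCoeff f n = fourierCoeffOn hT v n := by
      intro n
      rw [fourierCoeffOn_eq_integral, fourierCoeff_eq_intervalIntegral _ n 0]
      simp only [hf]
      rw [show (0:ℝ) + (T - 0) = T by ring]
    have hcz : ∀ n ∉ ({1, -1} : Finset ℤ), fourierCoeff f n = 0 := by
      intro n hn
      simp only [Finset.mem_insert, Finset.mem_singleton, not_or] at hn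
      rw [hcoef]; exact cz n hn.1 hn.2
    have hs : Summable (fourierCoeff f) := summable_of_ne_finset_zero hcz
    refine ⟨fourierCoeff f 1, fourierCoeff f (-1), fun x => ?_⟩
    have h1 := has_pointwise_sum_fourier_series_of_summable hs (x : AddCircle (T - 0))
    have h2 := hasSum_sum_of_ne_finset_zero (L := SummationFilter.unconditional ℤ) (s := ({1, -1} : Finset ℤ))
      (f := fun i => fourierCoeff f i • fourier i (x : AddCircle (T - 0)))
      (fun n hn => by simp [hcz n hn])
    have h3 := h1.unique h2
    rw [hf, Finset.sum_pair (by norm_num), fourier_coe_apply, fourier_coe_apply] at h3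
    rw [h3]
    simp only [smul_eq_mul]
    push_cast
    congr 3 <;> congr 1 <;> ring

lemma aux_L4 (T ρ : ℝ) (hT : 0 < T) (v : ℝ → ℂ) (hc : Continuous v)
    (hm : ∫ x in (0:ℝ)..T, ‖v x‖^2 = ρ * T) :
    ρ^2 * T ≤ ∫ x in (0:ℝ)..T, ‖v x‖^4 ∧
    (ρ^2 * T = ∫ x in (0:ℝ)..T, ‖v x‖^4 → ∀ x ∈ Set.Icc 0 T, ‖v x‖^2 = ρ) := by
  have hI : ∫ x in (0:ℝ)..T, (‖v x‖^2 - ρ)^2 = (∫ x in (0:ℝ)..T, ‖v x‖^4) - ρ^2 * T := by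
    have : ∀ x, (‖v x‖^2 - ρ)^2 = ‖v x‖^4 - 2 * ρ * ‖v x‖^2 + ρ^2 := fun x => by ring
    simp only [this]
    rw [intervalIntegral.integral_add, intervalIntegral.integral_sub,
      intervalIntegral.integral_const_mul, hm, intervalIntegral.integral_const]
    · simp; ring
    all_goals exact Continuous.intervalIntegrable (by fun_prop) _ _
  constructor
  · have : 0 ≤ ∫ x in (0:ℝ)..T, (‖v x‖^2 - ρ)^2 :=
      intervalIntegral.integral_nonneg hT.le (fun x _ => by positivity)
    linarith
  · intro heq x hx
    by_contra hne
    have : 0 < ∫ x in (0:ℝ)..T, (‖v x‖^2 - ρ)^2 :=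
      intervalIntegral.integral_pos hT (by fun_prop) (fun x _ => by positivity)
        ⟨x, hx, by have : ‖v x‖^2 - ρ ≠ 0 := sub_ne_zero.mpr hne
                   positivity⟩
    linarith

lemma aux_alg (A B : ℂ) (ρ : ℝ) (h0 : ‖A + B‖^2 = ρ) (h1 : ‖A - B‖^2 = ρ)
    (h2 : ‖A - Complex.I * B‖^2 = ρ) :
    (B = 0 ∧ ‖A‖^2 = ρ) ∨ (A = 0 ∧ ‖B‖^2 = ρ) := by
  have e0 := h0
  have e1 := h1
  simp only [Complex.sq_norm, Complex.normSq_apply, Complex.add_re, Complex.add_im,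
    Complex.sub_re, Complex.sub_im, Complex.mul_re, Complex.mul_im, Complex.I_re,
    Complex.I_im] at h0 h1 h2
  have hre : A.re * B.re + A.im * B.im = 0 := by linarith
  have him : A.re * B.im - A.im * B.re = 0 := by linarith
  have hpr : (A.re^2 + A.im^2) * (B.re^2 + B.im^2) = 0 := by
    have : (A.re^2 + A.im^2) * (B.re^2 + B.im^2) = (A.re * B.re + A.im * B.im)^2
      + (A.re * B.im - A.im * B.re)^2 := by ring
    rw [this, hre, him]; ring
  rcases mul_eq_zero.mp hpr with h | h
  · right
    have hA : A = 0 := Complex.ext (by simp; nlinarith [sq_nonneg A.re, sq_nonneg A.im])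
      (by simp; nlinarith [sq_nonneg A.re, sq_nonneg A.im])
    exact ⟨hA, by simpa [hA] using e0⟩
  · left
    have hB : B = 0 := Complex.ext (by simp; nlinarith [sq_nonneg B.re, sq_nonneg B.im])
      (by simp; nlinarith [sq_nonneg B.re, sq_nonneg B.im])
    exact ⟨hB, by simpa [hB] using e0⟩

lemma aux_exp_norm (T x : ℝ) : ‖Complex.exp (2 * π * Complex.I * x / T)‖ = 1 := by
  have : (2 * π * Complex.I * x / T : ℂ) = ((2 * π * x / T : ℝ) : ℂ) * Complex.I := by
    push_cast; ring
  rw [this, Complex.norm_exp_ofReal_mul_I]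

lemma aux_exp (T : ℝ) (hT : 0 < T) :
    Complex.exp (2 * π * Complex.I * (T/4 : ℝ) / T) = Complex.I ∧
    Complex.exp (2 * π * Complex.I * (T/8 : ℝ) / T) ^ 2 = Complex.I := by
  have hTC : (T : ℂ) ≠ 0 := by exact_mod_cast hT.ne'
  have h : Complex.exp (2 * π * Complex.I * (T/4 : ℝ) / T) = Complex.I := by
    rw [show (2 * π * Complex.I * (T/4 : ℝ) / T : ℂ) = π / 2 * Complex.I by
      push_cast; field_simp; norm_num]
    exact Complex.exp_pi_div_two_mul_I
  refine ⟨h, ?_⟩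
  rw [← Complex.exp_nat_mul]
  refine Eq.trans ?_ h
  congr 1
  push_cast; ring

lemma aux_u_anti (T a : ℝ) (hT : 0 < T) (x : ℝ) :
    (a : ℂ) * Complex.exp (2 * π * Complex.I * (x + T/2 : ℝ) / T)
      = -((a : ℂ) * Complex.exp (2 * π * Complex.I * x / T)) := by
  have hTC : (T : ℂ) ≠ 0 := by exact_mod_cast hT.ne'
  rw [show (2 * π * Complex.I * (x + T/2 : ℝ) / T : ℂ)
    = 2 * π * Complex.I * x / T + π * Complex.I by push_cast; field_simp,
    Complex.exp_add, Complex.exp_pi_mul_I]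
  ring

lemma aux_u_norm (T a : ℝ) (ha : 0 ≤ a) (x : ℝ) :
    ‖(a : ℂ) * Complex.exp (2 * π * Complex.I * x / T)‖ = a := by
  rw [norm_mul, aux_exp_norm, mul_one, Complex.norm_real, Real.norm_eq_abs, abs_of_nonneg ha]

lemma aux_u_deriv (T a : ℝ) (hT : 0 < T) (ha : 0 ≤ a) (x : ℝ) :
    ‖deriv (fun x : ℝ => (a : ℂ) * Complex.exp (2 * π * Complex.I * x / T)) x‖ = a * (2*π/T) := by
  have h1 : HasDerivAt (fun x : ℝ => (2 * π * Complex.I * x / T : ℂ))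
      (2 * π * Complex.I / T) x := by
    have := ((Complex.ofRealCLM.hasDerivAt (x := x)).const_mul
      (2 * π * Complex.I : ℂ)).div_const (T : ℂ)
    simpa using this
  rw [(h1.cexp.const_mul (a : ℂ)).deriv, ← mul_assoc, norm_mul, aux_u_norm T a ha]
  have : (2 * π * Complex.I / T : ℂ) = ((2 * π / T : ℝ) : ℂ) * Complex.I := by
    push_cast; ring
  rw [this, norm_mul, Complex.norm_I, Complex.norm_real, Real.norm_eq_abs, mul_one,
    abs_of_pos (by positivity)]

lemma aux_main (b T m : ℝ) (hb : b < 0) (hT : 0 < T) (hm : 0 < m) (v : ℝ → ℂ)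
    (hv : ContDiff ℝ 1 v) (ha : ∀ x, v (x + T/2) = -v x) (hmv : nlsMass T v = m)
    (hle : nlsEnergy b T v ≤ nlsEnergy b T (fun x : ℝ => (Real.sqrt (2*m/T) : ℂ) *
        Complex.exp (2 * π * Complex.I * x / T))) :
    nlsEnergy b T v = nlsEnergy b T (fun x : ℝ => (Real.sqrt (2*m/T) : ℂ) *
        Complex.exp (2 * π * Complex.I * x / T)) ∧ ∃ c : ℂ, ‖c‖ = 1 ∧
        ((∀ x : ℝ, v x = c * (Real.sqrt (2*m/T) : ℂ) * Complex.exp (2 * π * Complex.I * x / T)) ∨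
         (∀ x : ℝ, v x = c * (Real.sqrt (2*m/T) : ℂ) *
          Complex.exp (-(2 * π * Complex.I * x / T)))) := by
  have hρ : 0 < 2*m/T := by positivity
  have hs : Real.sqrt (2*m/T) ^ 2 = 2*m/T := Real.sq_sqrt hρ.le
  have hspos : 0 < Real.sqrt (2*m/T) := Real.sqrt_pos.mpr hρ
  have hM : ∫ x in (0:ℝ)..T, ‖v x‖^2 = 2*m/T * T := by
    unfold nlsMass at hmv
    rw [div_mul_cancel₀ _ hT.ne']; linarith
  have hE : nlsEnergy b T (fun x : ℝ => (Real.sqrt (2*m/T) : ℂ) *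
        Complex.exp (2 * π * Complex.I * x / T))
      = (1/2) * ((2*π/T)^2 * (2*m/T*T)) - (b/4) * ((2*m/T)^2 * T) := by
    unfold nlsEnergy
    simp only [aux_u_deriv T _ hT hspos.le, aux_u_norm T _ hspos.le,
      intervalIntegral.integral_const, smul_eq_mul, sub_zero]
    rw [mul_pow, show Real.sqrt (2*m/T) ^ 4 = (Real.sqrt (2*m/T) ^ 2)^2 by ring, hs]
    ring
  obtain ⟨w1, w2⟩ := aux_wirt T hT v hv ha
  obtain ⟨q1, q2⟩ := aux_L4 T (2*m/T) hT v hv.continuous hM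
  rw [hM] at w1 w2
  rw [hE] at hle ⊢
  unfold nlsEnergy at hle ⊢
  set D := ∫ x in (0:ℝ)..T, ‖deriv v x‖^2
  set Q := ∫ x in (0:ℝ)..T, ‖v x‖^4
  have hbq : 0 ≤ (-b/4) * (Q - (2*m/T)^2 * T) :=
    mul_nonneg (by linarith) (by linarith)
  have hD : (2*π/T)^2 * (2*m/T*T) = D := by nlinarith
  have hQ : (2*m/T)^2 * T = Q := by
    have : (-b/4) * (Q - (2*m/T)^2 * T) = 0 := by nlinarith
    rcases mul_eq_zero.mp this with h | h <;> linarith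
  refine ⟨by rw [hD, hQ], ?_⟩
  obtain ⟨A, B, hAB⟩ := w2 hD
  have hn := q2 hQ
  obtain ⟨x4, x8⟩ := aux_exp T hT
  have n8 := aux_exp_norm T (T/8)
  have k0 : ‖A + B‖^2 = 2*m/T := by
    have := hn 0 ⟨le_rfl, hT.le⟩
    rw [hAB] at this
    simpa using this
  have k1 : ‖A - B‖^2 = 2*m/T := by
    have := hn (T/4) ⟨by positivity, by linarith⟩
    rw [hAB, Complex.exp_neg, x4, Complex.inv_I,
      show A * Complex.I + B * -Complex.I = (A - B) * Complex.I by ring, norm_mul,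
      Complex.norm_I, mul_one] at this
    exact this
  have k2 : ‖A - Complex.I * B‖^2 = 2*m/T := by
    have := hn (T/8) ⟨by positivity, by linarith⟩
    rw [hAB, Complex.exp_neg] at this
    set E := Complex.exp (2 * π * Complex.I * (T/8 : ℝ) / T)
    have hE0 : E ≠ 0 := Complex.exp_ne_zero _
    have hEi : E⁻¹ = - Complex.I * E := by
      symm
      apply eq_inv_of_mul_eq_one_left
      rw [mul_assoc, ← sq, x8]
      simp
    rw [hEi, show A * E + B * (-Complex.I * E) = (A - Complex.I * B) * E by ring, norm_mul,
      n8, mul_one] at this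
    exact this
  have hsC : (Real.sqrt (2*m/T) : ℂ) ≠ 0 := by exact_mod_cast hspos.ne'
  have hcn : ∀ C : ℂ, ‖C‖^2 = 2*m/T → ‖C / (Real.sqrt (2*m/T) : ℂ)‖ = 1 := by
    intro C hC
    rw [norm_div, Complex.norm_real, Real.norm_eq_abs, abs_of_pos hspos, ← hC,
      Real.sqrt_sq (norm_nonneg _)]
    apply div_self
    intro h
    rw [h] at hC
    norm_num at hC
    linarith
  rcases aux_alg A B _ k0 k1 k2 with ⟨hB, hA⟩ | ⟨hA, hB⟩
  · refine ⟨A / (Real.sqrt (2*m/T) : ℂ), hcn A hA, Or.inl fun x => ?_⟩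
    rw [div_mul_cancel₀ _ hsC, hAB, hB]; ring
  · refine ⟨B / (Real.sqrt (2*m/T) : ℂ), hcn B hB, Or.inr fun x => ?_⟩
    rw [div_mul_cancel₀ _ hsC, hAB, hA]; ring

/-- Defocusing case, half-anti-periodic functions: the plane wave
`√(2m/T) e^{2πix/T}` is the unique (up to phase and complex conjugation)
minimizer of the energy at fixed mass `m` among `T/2`-anti-periodic
functions. -/
theorem stmt_11 (b T m : ℝ) (hb : b < 0) (hT : 0 < T) (hm : 0 < m) :
    (∀ x : ℝ, (fun x : ℝ => (Real.sqrt (2*m/T) : ℂ) *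
        Complex.exp (2 * π * Complex.I * x / T)) (x + T/2)
      = -(fun x : ℝ => (Real.sqrt (2*m/T) : ℂ) *
        Complex.exp (2 * π * Complex.I * x / T)) x) ∧
    nlsMass T (fun x : ℝ => (Real.sqrt (2*m/T) : ℂ) *
        Complex.exp (2 * π * Complex.I * x / T)) = m ∧
    (∀ v : ℝ → ℂ, ContDiff ℝ 1 v → (∀ x, v (x + T/2) = -v x) → nlsMass T v = m →
      nlsEnergy b T (fun x : ℝ => (Real.sqrt (2*m/T) : ℂ) *
        Complex.exp (2 * π * Complex.I * x / T)) ≤ nlsEnergy b T v) ∧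
    (∀ v : ℝ → ℂ, ContDiff ℝ 1 v → (∀ x, v (x + T/2) = -v x) → nlsMass T v = m →
      (¬ ∃ c : ℂ, ‖c‖ = 1 ∧
        ((∀ x, v x = c * (Real.sqrt (2*m/T) : ℂ) * Complex.exp (2 * π * Complex.I * x / T)) ∨
         (∀ x, v x = c * (Real.sqrt (2*m/T) : ℂ) * Complex.exp (-(2 * π * Complex.I * x / T))))) →
      nlsEnergy b T (fun x : ℝ => (Real.sqrt (2*m/T) : ℂ) *
        Complex.exp (2 * π * Complex.I * x / T)) < nlsEnergy b T v) := by
  refine ⟨fun x => aux_u_anti T _ hT x, ?_, ?_, ?_⟩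
  · have hρ : 0 < 2*m/T := by positivity
    have hs : Real.sqrt (2*m/T) ^ 2 = 2*m/T := Real.sq_sqrt hρ.le
    unfold nlsMass
    simp only [aux_u_norm T _ (Real.sqrt_nonneg _), intervalIntegral.integral_const, smul_eq_mul,
      sub_zero, hs]
    field_simp
  · intro v hv ha hmv
    by_contra h
    exact h (aux_main b T m hb hT hm v hv ha hmv (not_le.mp h).le).1.ge
  · intro v hv ha hmv hne
    by_contra h
    exact hne (aux_main b T m hb hT hm v hv ha hmv (not_lt.mp h)).2
end
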